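/- (Moonlight Theorem) Let k ≥ 0 and m ≥ 0 be natural numbers and let X be a bulb-headed component with g(X) = ∞. Then g(bulb^k ++ socket^m ++ X) = ∞. -/

import Mathlib

/-- A piece of a Christmas lights' fixture: a (broken-but-replaceable) bulb
or a (broken) socket. -/
inductive Piece : Type
  | bulb : Piece
  | socket : Piece
  deriving DecidableEq

/-- A component is a finite list of pieces; index 0 is nearest the plug. -/
abbrev Component := List Piece

/-- A sequence of `n` bulbs. -/
def bulbs (n : ℕ) : Component := List.replicate n Piece.bulb

/-- A sequence of `m` sockets. -/
def sockets (m : ℕ) : Component := List.replicate m Piece.socket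

/-- The entries at positions `i-1` and `i+1` both exist and both equal bulb. -/
def Sandwiched (L : Component) (i : ℕ) : Prop :=
  0 < i ∧ L[i-1]? = some Piece.bulb ∧ L[i+1]? = some Piece.bulb

/-- `L'` is obtained from `L` by a quiet move: either fix a bulb (truncating
everything to its right), or remove a socket that is not sandwiched between
two bulbs. -/
def QuietOption (L L' : Component) : Prop :=
  (∃ i, L[i]? = some Piece.bulb ∧ L' = L.take i) ∨
  (∃ i, L[i]? = some Piece.socket ∧ ¬ Sandwiched L i ∧ L' = L.eraseIdx i)

/-- `L'` is obtained from `L` by a carry-on move: remove a socket sandwiched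
between two bulbs (the mover must move again). -/
def CarryOption (L L' : Component) : Prop :=
  ∃ i, L[i]? = some Piece.socket ∧ Sandwiched L i ∧ L' = L.eraseIdx i

/-- A position is a finite multiset of components. -/
abbrev Position := Multiset Component

/-- Total number of pieces in a position. -/
def Position.size (pos : Position) : ℕ := (pos.map List.length).sum

/-- Fuel-indexed winning predicate; `WinN n pos` agrees with the intended
`Win pos` whenever `n ≥ Position.size pos`, since every move strictly
decreases the total number of pieces. -/
def WinN : ℕ → Position → Prop
  | 0, _ => False
  | n+1, pos =>
      (∃ L ∈ pos, ∃ L', QuietOption L L' ∧ ¬ WinN n (L' ::ₘ pos.erase L)) ∨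
      (∃ L ∈ pos, ∃ L', CarryOption L L' ∧ WinN n (L' ::ₘ pos.erase L))

/-- The player to move wins `pos` (normal play convention): some quiet move
leads to a losing position for the opponent, or some carry-on move leads to a
position the mover (still to move) wins. -/
def Win (pos : Position) : Prop := WinN (Position.size pos) pos

open Classical in
/-- Fuel-indexed extended Grundy value; `gN n L` agrees with the intended
value whenever `n ≥ L.length`, since every option of `L` is strictly
shorter. -/
noncomputable def gN : ℕ → Component → ℕ∞
  | 0, _ => 0
  | n+1, L =>
      let S : Set ℕ := {k | ∃ L', QuietOption L L' ∧ gN n L' = (k : ℕ∞)}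
      let C : Set ℕ∞ := {v | ∃ L', CarryOption L L' ∧ gN n L' = v}
      if (⊤ : ℕ∞) ∈ C ∨ (∃ a ∈ C, ∃ b ∈ C, a ≠ b) ∨
          (∃ k : ℕ, C = {(k : ℕ∞)} ∧ k ∈ S) then ⊤
      else if h : ∃ k : ℕ, C = {(k : ℕ∞)} ∧ k ∉ S then (h.choose : ℕ∞)
      else ((sInf {k : ℕ | k ∉ S} : ℕ) : ℕ∞)

/-- The extended Grundy value `g L ∈ ℕ ∪ {∞}` of a component. -/
noncomputable def g (L : Component) : ℕ∞ := gN L.length L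

/-- A component is bulb-headed if it is empty or its first piece is a bulb. -/
def BulbHeaded (L : Component) : Prop := L = [] ∨ L.head? = some Piece.bulb

/-! ### Unfolding the extended Grundy value -/

/-- The finite Grundy values of the quiet options of `L`. -/
def quietValues (L : Component) : Set ℕ := {n | ∃ L', QuietOption L L' ∧ g L' = (n : ℕ∞)}

/-- The extended Grundy values of the carry-on options of `L`. -/
def carryValues (L : Component) : Set ℕ∞ := {v | ∃ L', CarryOption L L' ∧ g L' = v}

open Classical in
/-- The extended Grundy value of a component with finite quiet values `S` and carry-on
values `C`. -/
noncomputable def optionValue (S : Set ℕ) (C : Set ℕ∞) : ℕ∞ :=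
  if (⊤ : ℕ∞) ∈ C ∨ (∃ a ∈ C, ∃ b ∈ C, a ≠ b) ∨ (∃ k : ℕ, C = {(k : ℕ∞)} ∧ k ∈ S) then ⊤
  else if h : ∃ k : ℕ, C = {(k : ℕ∞)} ∧ k ∉ S then (h.choose : ℕ∞)
  else ((sInf {k : ℕ | k ∉ S} : ℕ) : ℕ∞)

theorem gN_succ (n : ℕ) (L : Component) :
    gN (n + 1) L = optionValue {k | ∃ L', QuietOption L L' ∧ gN n L' = (k : ℕ∞)}
      {v | ∃ L', CarryOption L L' ∧ gN n L' = v} := rfl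

theorem lt_length_of_getElem?_eq_some {L : Component} {i : ℕ} {p : Piece}
    (h : L[i]? = some p) : i < L.length :=
  (List.getElem?_eq_some_iff.1 h).1

theorem QuietOption.length_lt {L L' : Component} (h : QuietOption L L') :
    L'.length < L.length := by
  rcases h with ⟨i, hi, rfl⟩ | ⟨i, hi, -, rfl⟩
  · have := lt_length_of_getElem?_eq_some hi
    simp [this]
  · have := lt_length_of_getElem?_eq_some hi
    rw [List.length_eraseIdx_of_lt this]
    omega

theorem CarryOption.length_lt {L L' : Component} (h : CarryOption L L') :
    L'.length < L.length := by
  obtain ⟨i, hi, -, rfl⟩ := h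
  have := lt_length_of_getElem?_eq_some hi
  rw [List.length_eraseIdx_of_lt this]
  omega

theorem not_quietOption_nil (L' : Component) : ¬ QuietOption [] L' :=
  fun h => by simpa using QuietOption.length_lt h

theorem not_carryOption_nil (L' : Component) : ¬ CarryOption [] L' :=
  fun h => by simpa using CarryOption.length_lt h

theorem gN_succ_congr {a b : ℕ} {L : Component}
    (hq : ∀ L', QuietOption L L' → gN a L' = gN b L')
    (hc : ∀ L', CarryOption L L' → gN a L' = gN b L') : gN (a + 1) L = gN (b + 1) L := by
  have hS : {k : ℕ | ∃ L', QuietOption L L' ∧ gN a L' = (k : ℕ∞)} =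
      {k : ℕ | ∃ L', QuietOption L L' ∧ gN b L' = (k : ℕ∞)} := by
    ext k
    exact exists_congr fun L' => and_congr_right fun h => by rw [hq L' h]
  have hC : {v : ℕ∞ | ∃ L', CarryOption L L' ∧ gN a L' = v} =
      {v : ℕ∞ | ∃ L', CarryOption L L' ∧ gN b L' = v} := by
    ext v
    exact exists_congr fun L' => and_congr_right fun h => by rw [hc L' h]
  rw [gN_succ, gN_succ, hS, hC]

theorem gN_one_nil : gN 1 [] = 0 := by
  simp [gN, not_quietOption_nil, not_carryOption_nil, Set.eq_singleton_iff_unique_mem]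

theorem gN_eq_g (n : ℕ) (L : Component) (h : L.length ≤ n) : gN n L = g L := by
  induction n using Nat.strong_induction_on generalizing L with
  | _ n ih =>
    rcases n with _ | n
    · rw [List.length_eq_zero_iff.1 (Nat.le_zero.1 h)]
      rfl
    · rcases hL : L.length with _ | l
      · obtain rfl := List.length_eq_zero_iff.1 hL
        have : gN (n + 1) [] = gN (0 + 1) [] :=
          gN_succ_congr (fun L' h' => (not_quietOption_nil L' h').elim)
            (fun L' h' => (not_carryOption_nil L' h').elim)
        rw [this]
        exact gN_one_nil
      · have key : ∀ L' : Component, L'.length < L.length → gN n L' = gN l L' := by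
          intro L' h'
          rw [ih n (by omega) L' (by omega), ih l (by omega) L' (by omega)]
        rw [g, hL]
        exact gN_succ_congr (fun L' h' => key L' h'.length_lt) (fun L' h' => key L' h'.length_lt)

theorem g_eq_optionValue (L : Component) :
    g L = optionValue (quietValues L) (carryValues L) := by
  have hS : {k : ℕ | ∃ L', QuietOption L L' ∧ gN L.length L' = (k : ℕ∞)} = quietValues L := by
    ext k
    exact exists_congr fun L' => and_congr_right fun h => by rw [gN_eq_g _ _ h.length_lt.le]
  have hC : {v : ℕ∞ | ∃ L', CarryOption L L' ∧ gN L.length L' = v} = carryValues L := by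
    ext v
    exact exists_congr fun L' => and_congr_right fun h => by rw [gN_eq_g _ _ h.length_lt.le]
  rw [← gN_eq_g (L.length + 1) L (Nat.le_succ _), gN_succ, hS, hC]

theorem finite_quietValues (L : Component) : (quietValues L).Finite := by
  have h : {L' | QuietOption L L'}.Finite := by
    refine (((Set.finite_lt_nat L.length).image L.take).union
      ((Set.finite_lt_nat L.length).image L.eraseIdx)).subset ?_
    rintro L' (⟨i, hi, rfl⟩ | ⟨i, hi, -, rfl⟩)
    · exact Or.inl ⟨i, lt_length_of_getElem?_eq_some hi, rfl⟩
    · exact Or.inr ⟨i, lt_length_of_getElem?_eq_some hi, rfl⟩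
  refine (h.image fun L' => (g L').toNat).subset ?_
  rintro n ⟨L', hL', hn⟩
  exact ⟨L', hL', by simp [hn]⟩

theorem g_eq_top_iff (L : Component) :
    g L = ⊤ ↔ ⊤ ∈ carryValues L ∨ (∃ a ∈ carryValues L, ∃ b ∈ carryValues L, a ≠ b) ∨
      ∃ n : ℕ, (n : ℕ∞) ∈ carryValues L ∧ n ∈ quietValues L := by
  rw [g_eq_optionValue, optionValue]
  constructor
  · intro h
    split_ifs at h with h1 h2
    · rcases h1 with h1 | h1 | ⟨n, hC, hn⟩
      · exact Or.inl h1
      · exact Or.inr (Or.inl h1)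
      · exact Or.inr (Or.inr ⟨n, by simp [hC], hn⟩)
    · exact absurd h (ENat.natCast_ne_top _)
    · exact absurd h (ENat.natCast_ne_top _)
  · intro h
    refine if_pos ?_
    rcases h with h | h | ⟨n, hC, hn⟩
    · exact Or.inl h
    · exact Or.inr (Or.inl h)
    · by_cases hu : ∀ a ∈ carryValues L, a = n
      · exact Or.inr (Or.inr ⟨n, Set.eq_singleton_iff_unique_mem.2 ⟨hC, hu⟩, hn⟩)
      · push Not at hu
        obtain ⟨a, ha, hne⟩ := hu
        exact Or.inr (Or.inl ⟨a, ha, n, hC, hne⟩)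

theorem g_eq_coe_iff (L : Component) (n : ℕ) :
    g L = n ↔ n ∉ quietValues L ∧
      (carryValues L = {(n : ℕ∞)} ∨ carryValues L = ∅ ∧ ∀ v < n, v ∈ quietValues L) := by
  have hne : {k : ℕ | k ∉ quietValues L}.Nonempty :=
    (finite_quietValues L).infinite_compl.nonempty
  constructor
  · intro h
    have htop : g L ≠ ⊤ := by simp [h]
    rw [Ne, g_eq_top_iff] at htop
    push Not at htop
    obtain ⟨h1, h2, h3⟩ := htop
    rw [g_eq_optionValue, optionValue] at h
    split_ifs at h with h4 h5
    · exact absurd h.symm (ENat.natCast_ne_top _)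
    · obtain ⟨hC, hS⟩ := h5.choose_spec
      rw [Nat.cast_inj.1 h] at hC hS
      exact ⟨hS, Or.inl hC⟩
    · have hn := Nat.cast_inj.1 h
      refine ⟨hn ▸ Nat.sInf_mem hne, Or.inr ⟨?_, fun v hv => ?_⟩⟩
      · by_contra hC
        obtain ⟨a, ha⟩ := Set.nonempty_iff_ne_empty.2 hC
        have hat : a ≠ ⊤ := fun h => h1 (h ▸ ha)
        lift a to ℕ using hat
        exact h5 ⟨a, Set.eq_singleton_iff_unique_mem.2 ⟨ha, fun b hb => h2 b hb a ha⟩, h3 a ha⟩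
      · by_contra hS
        exact absurd (hn ▸ Nat.sInf_le hS : n ≤ v) (by omega)
  · rintro ⟨hn, h⟩
    have htop : g L ≠ ⊤ := by
      rw [Ne, g_eq_top_iff]
      rcases h with h | ⟨h, -⟩
      · simpa [h] using hn
      · simp [h]
    rw [g_eq_optionValue, optionValue] at htop ⊢
    split_ifs at htop ⊢ with h1 h2
    · simp at htop
    · have hC := h2.choose_spec.1
      rcases h with h | ⟨h, -⟩
      · exact Set.singleton_injective (hC.symm.trans h)
      · exact absurd (hC.symm.trans h) (Set.singleton_ne_empty _)
    · rcases h with h | ⟨-, h⟩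
      · exact absurd ⟨n, h, hn⟩ h2
      · refine congrArg _ (le_antisymm (Nat.sInf_le hn) ?_)
        by_contra hlt
        exact Nat.sInf_mem hne (h _ (not_le.1 hlt))

theorem g_nil : g [] = 0 := rfl

/-! ### Options of a component with a prefix of bulbs and sockets -/

theorem getElem?_prefix (k m : ℕ) (X : Component) (i : ℕ) :
    (bulbs k ++ sockets m ++ X)[i]? =
      if i < k then some Piece.bulb else if i < k + m then some Piece.socket
      else X[i - (k + m)]? := by
  simp only [bulbs, sockets, List.getElem?_append, List.length_append, List.length_replicate,
    List.getElem?_replicate]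
  grind

theorem BulbHeaded.getElem?_zero {X : Component} (hX : BulbHeaded X) (hne : X ≠ []) :
    X[0]? = some Piece.bulb := by
  rcases hX with h | h
  · exact absurd h hne
  · rwa [← List.head?_eq_getElem?]

theorem BulbHeaded.pos_of_socket {X : Component} (hX : BulbHeaded X) {i : ℕ}
    (hi : X[i]? = some Piece.socket) : 0 < i := by
  rcases Nat.eq_zero_or_pos i with rfl | h
  · rcases hX with rfl | h
    · simp at hi
    · rw [List.head?_eq_getElem?, hi] at h
      simp at h
  · exact h

theorem BulbHeaded.take {X : Component} (hX : BulbHeaded X) (i : ℕ) : BulbHeaded (X.take i) := by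
  rcases i with _ | i
  · exact Or.inl (by simp)
  · rcases hX with rfl | h
    · exact Or.inl (by simp)
    · exact Or.inr (by rw [List.head?_take, if_neg (by omega), h])

theorem BulbHeaded.eraseIdx {X : Component} (hX : BulbHeaded X) {i : ℕ}
    (hi : X[i]? = some Piece.socket) : BulbHeaded (X.eraseIdx i) := by
  have hpos := hX.pos_of_socket hi
  rcases hX with rfl | h
  · simp at hi
  · refine Or.inr ?_
    rw [List.head?_eq_getElem?, List.getElem?_eraseIdx_of_lt hpos, ← List.head?_eq_getElem?, h]

theorem BulbHeaded.quietOption {X X' : Component} (hX : BulbHeaded X) (h : QuietOption X X') :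
    BulbHeaded X' := by
  rcases h with ⟨i, -, rfl⟩ | ⟨i, hi, -, rfl⟩
  · exact hX.take i
  · exact hX.eraseIdx hi

theorem BulbHeaded.carryOption {X X' : Component} (hX : BulbHeaded X) (h : CarryOption X X') :
    BulbHeaded X' := by
  obtain ⟨i, hi, -, rfl⟩ := h
  exact hX.eraseIdx hi

theorem sandwiched_prefix_add (k m : ℕ) (X : Component) {i : ℕ} (hi : 0 < i) :
    Sandwiched (bulbs k ++ sockets m ++ X) (k + m + i) ↔ Sandwiched X i := by
  have h1 : ¬ k + m + i - 1 < k := by omega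
  have h2 : ¬ k + m + i - 1 < k + m := by omega
  have h3 : ¬ k + m + i + 1 < k := by omega
  have h4 : ¬ k + m + i + 1 < k + m := by omega
  have h5 : k + m + i - 1 - (k + m) = i - 1 := by omega
  have h6 : k + m + i + 1 - (k + m) = i + 1 := by omega
  simp only [Sandwiched, getElem?_prefix, h1, h2, h3, h4, h5, h6, if_false]
  exact and_congr_left fun _ => by omega

theorem sandwiched_prefix_socket {k m : ℕ} {X : Component} (hX : BulbHeaded X) {i : ℕ}
    (h1 : k ≤ i) (h2 : i < k + m) :
    Sandwiched (bulbs k ++ sockets m ++ X) i ↔ (0 < k ∧ m = 1 ∧ X ≠ []) := by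
  simp only [Sandwiched, getElem?_prefix]
  constructor
  · rintro ⟨h3, h4, h5⟩
    have h6 : i - 1 < k := by
      by_contra h
      rw [if_neg h, if_pos (by omega)] at h4
      simp at h4
    rw [if_neg (by omega)] at h5
    have h7 : ¬ i + 1 < k + m := by
      intro h
      rw [if_pos h] at h5
      simp at h5
    rw [if_neg h7] at h5
    refine ⟨by omega, by omega, ?_⟩
    rintro rfl
    simp at h5
  · rintro ⟨h3, rfl, h4⟩
    obtain rfl : i = k := by omega
    refine ⟨h3, by rw [if_pos (by omega)], ?_⟩
    rw [if_neg (by omega), if_neg (by omega), Nat.sub_self]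
    exact hX.getElem?_zero h4

theorem eraseIdx_prefix_socket {k m : ℕ} (X : Component) {i : ℕ} (h1 : k ≤ i) (h2 : i < k + m) :
    (bulbs k ++ sockets m ++ X).eraseIdx i = bulbs k ++ sockets (m - 1) ++ X := by
  rw [List.eraseIdx_append_of_lt_length (by simpa [bulbs, sockets] using h2),
    List.eraseIdx_append_of_length_le (by simpa [bulbs] using h1)]
  have h3 : i - k < m := by omega
  simp [bulbs, sockets, List.eraseIdx_replicate, h3]

theorem eraseIdx_prefix_add (k m : ℕ) (X : Component) (i : ℕ) :
    (bulbs k ++ sockets m ++ X).eraseIdx (k + m + i) = bulbs k ++ sockets m ++ X.eraseIdx i := by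
  rw [List.eraseIdx_append_of_length_le (by simp [bulbs, sockets])]
  simp [bulbs, sockets]

theorem getElem?_prefix_add (k m : ℕ) (X : Component) (i : ℕ) :
    (bulbs k ++ sockets m ++ X)[k + m + i]? = X[i]? := by
  rw [getElem?_prefix, if_neg (by omega), if_neg (by omega), Nat.add_sub_cancel_left]

theorem socket_prefix_cases {k m : ℕ} {X : Component} {i : ℕ}
    (h : (bulbs k ++ sockets m ++ X)[i]? = some Piece.socket) :
    (k ≤ i ∧ i < k + m) ∨ ∃ j, i = k + m + j ∧ X[j]? = some Piece.socket := by
  rw [getElem?_prefix] at h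
  split_ifs at h with h1 h2
  · simp at h
  · exact Or.inl ⟨by omega, h2⟩
  · exact Or.inr ⟨i - (k + m), by omega, h⟩

theorem quietOption_prefix_iff {k m : ℕ} {X : Component} (hX : BulbHeaded X) (L' : Component) :
    QuietOption (bulbs k ++ sockets m ++ X) L' ↔
      (∃ i < k, L' = bulbs i) ∨
      (0 < m ∧ ¬ (0 < k ∧ m = 1 ∧ X ≠ []) ∧ L' = bulbs k ++ sockets (m - 1) ++ X) ∨
      ∃ X', QuietOption X X' ∧ L' = bulbs k ++ sockets m ++ X' := by
  constructor
  · rintro (⟨i, hi, rfl⟩ | ⟨i, hi, hs, rfl⟩)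
    · rw [getElem?_prefix] at hi
      split_ifs at hi with h1 h2
      · refine Or.inl ⟨i, h1, ?_⟩
        rw [List.append_assoc, List.take_append_of_le_length (by simpa [bulbs] using h1.le)]
        simp [bulbs, h1.le]
      · simp at hi
      · refine Or.inr (Or.inr ⟨_, Or.inl ⟨_, hi, rfl⟩, ?_⟩)
        rw [List.take_append, List.take_of_length_le (by simp [bulbs, sockets]; omega)]
        simp [bulbs, sockets]
    · rcases socket_prefix_cases hi with ⟨h1, h2⟩ | ⟨j, rfl, hj⟩
      · rw [sandwiched_prefix_socket hX h1 h2] at hs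
        exact Or.inr (Or.inl ⟨by omega, hs, eraseIdx_prefix_socket X h1 h2⟩)
      · rw [sandwiched_prefix_add k m X (hX.pos_of_socket hj)] at hs
        exact Or.inr (Or.inr ⟨_, Or.inr ⟨j, hj, hs, rfl⟩, eraseIdx_prefix_add k m X j⟩)
  · rintro (⟨i, hi, rfl⟩ | ⟨hm, hs, rfl⟩ | ⟨X', ⟨i, hi, rfl⟩ | ⟨i, hi, hs, rfl⟩, rfl⟩)
    · refine Or.inl ⟨i, by rw [getElem?_prefix, if_pos hi], ?_⟩
      rw [List.append_assoc, List.take_append_of_le_length (by simpa [bulbs] using hi.le)]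
      simp [bulbs, hi.le]
    · refine Or.inr ⟨k, by rw [getElem?_prefix, if_neg (by omega), if_pos (by omega)], ?_, ?_⟩
      · rwa [sandwiched_prefix_socket hX le_rfl (by omega)]
      · rw [eraseIdx_prefix_socket X le_rfl (by omega)]
    · refine Or.inl ⟨k + m + i, by rw [getElem?_prefix_add, hi], ?_⟩
      have hlen : (bulbs k ++ sockets m).length = k + m := by simp [bulbs, sockets]
      rw [← hlen, List.take_length_add_append]
    · refine Or.inr ⟨k + m + i, by rw [getElem?_prefix_add, hi], ?_, ?_⟩
      · rwa [sandwiched_prefix_add k m X (hX.pos_of_socket hi)]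
      · rw [eraseIdx_prefix_add]

theorem carryOption_prefix_iff {k m : ℕ} {X : Component} (hX : BulbHeaded X) (L' : Component) :
    CarryOption (bulbs k ++ sockets m ++ X) L' ↔
      ((0 < k ∧ m = 1 ∧ X ≠ []) ∧ L' = bulbs k ++ sockets (m - 1) ++ X) ∨
      ∃ X', CarryOption X X' ∧ L' = bulbs k ++ sockets m ++ X' := by
  constructor
  · rintro ⟨i, hi, hs, rfl⟩
    rcases socket_prefix_cases hi with ⟨h1, h2⟩ | ⟨j, rfl, hj⟩
    · rw [sandwiched_prefix_socket hX h1 h2] at hs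
      exact Or.inl ⟨hs, eraseIdx_prefix_socket X h1 h2⟩
    · rw [sandwiched_prefix_add k m X (hX.pos_of_socket hj)] at hs
      exact Or.inr ⟨_, ⟨j, hj, hs, rfl⟩, eraseIdx_prefix_add k m X j⟩
  · rintro (⟨hs, rfl⟩ | ⟨X', ⟨i, hi, hs, rfl⟩, rfl⟩)
    · refine ⟨k, by rw [getElem?_prefix, if_neg (by omega), if_pos (by omega)], ?_, ?_⟩
      · rwa [sandwiched_prefix_socket hX le_rfl (by omega)]
      · rw [eraseIdx_prefix_socket X le_rfl (by omega)]
    · refine ⟨k + m + i, by rw [getElem?_prefix_add, hi], ?_, ?_⟩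
      · rwa [sandwiched_prefix_add k m X (hX.pos_of_socket hi)]
      · rw [eraseIdx_prefix_add]

theorem g_bulbs (k : ℕ) : g (bulbs k) = k := by
  induction k using Nat.strong_induction_on with
  | _ k ih =>
    have hq : ∀ L', QuietOption (bulbs k) L' ↔ ∃ i < k, L' = bulbs i := fun L' => by
      simpa [sockets, not_quietOption_nil] using
        quietOption_prefix_iff (k := k) (m := 0) (X := []) (Or.inl rfl) L'
    have hc : ∀ L', ¬ CarryOption (bulbs k) L' := fun L' => by
      simpa [sockets, not_carryOption_nil] using
        carryOption_prefix_iff (k := k) (m := 0) (X := []) (Or.inl rfl) L'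
    rw [g_eq_coe_iff]
    refine ⟨?_, Or.inr ⟨?_, fun v hv => ⟨bulbs v, (hq _).2 ⟨v, hv, rfl⟩, ih v hv⟩⟩⟩
    · rintro ⟨L', hL', h⟩
      obtain ⟨i, hi, rfl⟩ := (hq L').1 hL'
      rw [ih i hi] at h
      exact hi.ne (Nat.cast_inj.1 h)
    · rw [Set.eq_empty_iff_forall_notMem]
      rintro v ⟨L', hL', -⟩
      exact hc L' hL'

theorem BulbHeaded.g_ne_zero {X : Component} (hX : BulbHeaded X) (hne : X ≠ []) : g X ≠ 0 := by
  intro h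
  refine ((g_eq_coe_iff X 0).1 h).1 ⟨[], Or.inl ⟨0, hX.getElem?_zero hne, by simp⟩, g_nil⟩

/-! ### The action of a prefix on Grundy values -/

/-- The exchange `2 * j ↔ 2 * j + 1`, that is, nim-addition of `1`. -/
def parityFlip (n : ℕ) : ℕ := n + 1 - 2 * (n % 2)

/-- The value of `bulbs k ++ sockets m ++ X`, when finite, as a function of `n = g X`. -/
def prefixNat (k m n : ℕ) : ℕ :=
  k + if m = 0 then n
    else if k = 0 ∨ n ≤ 1 then (if m % 2 = 1 then parityFlip n else n)
    else (if m % 2 = 1 then n else parityFlip n)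

/-- The value of `bulbs k ++ sockets m ++ X` as a function of `n = g X`. -/
def prefixValue (k m n : ℕ) : ℕ∞ :=
  if 0 < k ∧ m = 1 ∧ n = 1 then ⊤ else (prefixNat k m n : ℕ∞)

theorem prefixNat_injective (k m : ℕ) : Function.Injective (prefixNat k m) := by
  intro a b h
  unfold prefixNat parityFlip at h
  split_ifs at h <;> omega

theorem prefixValue_injective (k m : ℕ) : Function.Injective (prefixValue k m) := by
  intro a b h
  unfold prefixValue at h
  split_ifs at h with h1 h2 h2
  · omega
  · exact absurd h.symm (ENat.natCast_ne_top _)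
  · exact absurd h (ENat.natCast_ne_top _)
  · exact prefixNat_injective k m (Nat.cast_inj.1 h)

theorem le_prefixNat (k m n : ℕ) : k ≤ prefixNat k m n := Nat.le_add_right _ _

theorem prefixNat_pred_ne {k m n : ℕ} (hm : 0 < m) (h : ¬ (0 < k ∧ m = 1 ∧ n ≠ 0)) :
    prefixNat k (m - 1) n ≠ prefixNat k m n := by
  unfold prefixNat parityFlip
  split_ifs <;> omega

theorem prefixNat_sub_prefixNat {k m v : ℕ} (hv : k ≤ v) :
    prefixNat k m (prefixNat k m (v - k) - k) = v := by
  unfold prefixNat parityFlip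
  simp only [Nat.add_sub_cancel_left]
  split_ifs <;> omega

theorem exists_prefixValue_eq_of_lt {k m n v : ℕ} (hs : ¬ (0 < k ∧ m = 1 ∧ n ≠ 0)) (hk : k ≤ v)
    (hv : v < prefixNat k m n) :
    (∃ n' < n, prefixValue k m n' = v) ∨ 0 < m ∧ prefixValue k (m - 1) n = v := by
  by_cases h : prefixNat k m (v - k) - k < n
  · refine Or.inl ⟨_, h, ?_⟩
    rw [prefixValue, if_neg (by omega), prefixNat_sub_prefixNat hk]
  · refine Or.inr ?_
    have key : 0 < m ∧ ¬ (0 < k ∧ m - 1 = 1 ∧ n = 1) ∧ prefixNat k (m - 1) n = v := by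
      unfold prefixNat parityFlip at *
      split_ifs at * <;> omega
    rw [prefixValue, if_neg key.2.1, key.2.2]
    exact ⟨key.1, rfl⟩

/-- The value of `bulbs k ++ sockets m ++ X` is determined by that of the bulb-headed `X`. -/
theorem g_prefix (k m : ℕ) (X : Component) (hX : BulbHeaded X) :
    (g X = ⊤ → g (bulbs k ++ sockets m ++ X) = ⊤) ∧
      ∀ n : ℕ, g X = n → g (bulbs k ++ sockets m ++ X) = prefixValue k m n := by
  induction hs : X.length + m using Nat.strong_induction_on generalizing X m with
  | _ s ih =>
  have ihq : ∀ X', QuietOption X X' → (g X' = ⊤ → g (bulbs k ++ sockets m ++ X') = ⊤) ∧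
      ∀ n : ℕ, g X' = n → g (bulbs k ++ sockets m ++ X') = prefixValue k m n := fun X' h' =>
    ih (X'.length + m) (by have := h'.length_lt; omega) m X' (hX.quietOption h') rfl
  have ihc : ∀ X', CarryOption X X' → (g X' = ⊤ → g (bulbs k ++ sockets m ++ X') = ⊤) ∧
      ∀ n : ℕ, g X' = n → g (bulbs k ++ sockets m ++ X') = prefixValue k m n := fun X' h' =>
    ih (X'.length + m) (by have := h'.length_lt; omega) m X' (hX.carryOption h') rfl
  have ihm : 0 < m → ∀ n : ℕ, g X = n →
      g (bulbs k ++ sockets (m - 1) ++ X) = prefixValue k (m - 1) n := fun hm =>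
    (ih (X.length + (m - 1)) (by omega) (m - 1) X hX rfl).2
  clear ih
  set T := bulbs k ++ sockets m ++ X
  have carry_top : ⊤ ∈ carryValues X → ⊤ ∈ carryValues T := by
    rintro ⟨X', h', hg⟩
    exact ⟨_, (carryOption_prefix_iff hX _).2 (Or.inr ⟨X', h', rfl⟩), (ihc X' h').1 hg⟩
  have carry_coe : ∀ n : ℕ, (n : ℕ∞) ∈ carryValues X → prefixValue k m n ∈ carryValues T := by
    rintro n ⟨X', h', hg⟩
    exact ⟨_, (carryOption_prefix_iff hX _).2 (Or.inr ⟨X', h', rfl⟩), (ihc X' h').2 n hg⟩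
  have quiet_coe : ∀ n v : ℕ, n ∈ quietValues X → prefixValue k m n = v → v ∈ quietValues T := by
    rintro n v ⟨X', h', hg⟩ hv
    exact ⟨_, (quietOption_prefix_iff hX _).2 (Or.inr (Or.inr ⟨X', h', rfl⟩)),
      ((ihq X' h').2 n hg).trans hv⟩
  refine ⟨fun hgX => ?_, fun n hgX => ?_⟩
  · rw [g_eq_top_iff] at hgX ⊢
    rcases hgX with h | ⟨a, ha, b, hb, hab⟩ | ⟨n, hC, hS⟩
    · exact Or.inl (carry_top h)
    · rcases eq_or_ne a ⊤ with rfl | hat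
      · exact Or.inl (carry_top ha)
      rcases eq_or_ne b ⊤ with rfl | hbt
      · exact Or.inl (carry_top hb)
      lift a to ℕ using hat
      lift b to ℕ using hbt
      exact Or.inr (Or.inl ⟨_, carry_coe a ha, _, carry_coe b hb, fun h =>
        hab (congrArg _ (prefixValue_injective k m h))⟩)
    · rcases eq_or_ne (prefixValue k m n) ⊤ with h | h
      · exact Or.inl (h ▸ carry_coe n hC)
      · obtain ⟨v, hv⟩ := ENat.ne_top_iff_exists.1 h
        exact Or.inr (Or.inr ⟨v, hv ▸ carry_coe n hC, quiet_coe n v hS hv.symm⟩)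
  · have hnil : X ≠ [] ↔ n ≠ 0 := by
      refine ⟨fun h h0 => hX.g_ne_zero h (by simp [hgX, h0]), ?_⟩
      rintro h rfl
      exact h (Nat.cast_inj.1 (hgX.symm.trans g_nil))
    obtain ⟨hS, hC⟩ := (g_eq_coe_iff X n).1 hgX
    have carry_pred : 0 < k → m = 1 → n ≠ 0 → ((k + n : ℕ) : ℕ∞) ∈ carryValues T := by
      rintro hk rfl hn
      refine ⟨_, (carryOption_prefix_iff hX _).2 (Or.inl ⟨⟨hk, rfl, hnil.2 hn⟩, rfl⟩), ?_⟩
      rw [ihm one_pos n hgX]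
      simp [prefixValue, prefixNat]
    by_cases htop : 0 < k ∧ m = 1 ∧ n = 1
    · have hval : prefixValue k m n = ⊤ := if_pos htop
      rw [hval, g_eq_top_iff]
      rcases hC with hC | ⟨-, hlt⟩
      · exact Or.inl (hval ▸ carry_coe n (by simp [hC]))
      · obtain ⟨hk, rfl, rfl⟩ := htop
        exact Or.inr (Or.inr ⟨k + 1, carry_pred hk rfl one_ne_zero,
          quiet_coe 0 (k + 1) (hlt 0 one_pos) (by simp [prefixValue, prefixNat, parityFlip])⟩)
    have hval : prefixValue k m n = prefixNat k m n := if_neg htop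
    rw [hval, g_eq_coe_iff]
    constructor
    · rintro ⟨L', hL', hg⟩
      rcases (quietOption_prefix_iff hX L').1 hL' with ⟨i, hi, rfl⟩ | ⟨hm, hs, rfl⟩ | ⟨X', h', rfl⟩
      · rw [g_bulbs] at hg
        have := le_prefixNat k m n
        have := Nat.cast_inj.1 hg
        omega
      · rw [hnil] at hs
        rw [ihm hm n hgX, prefixValue] at hg
        split_ifs at hg
        · exact ENat.natCast_ne_top _ hg.symm
        · exact prefixNat_pred_ne hm hs (Nat.cast_inj.1 hg)
      · rcases eq_or_ne (g X') ⊤ with h | h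
        · rw [(ihq X' h').1 h] at hg
          exact ENat.natCast_ne_top _ hg.symm
        · obtain ⟨a, ha⟩ := ENat.ne_top_iff_exists.1 h
          rw [(ihq X' h').2 a ha.symm, ← hval] at hg
          exact hS ⟨X', h', by rw [← ha, prefixValue_injective k m hg]⟩
    have carry_sub : ∀ v, (∃ X', CarryOption X X' ∧ g (bulbs k ++ sockets m ++ X') = v) →
        v = prefixNat k m n := by
      rintro v ⟨X', h', rfl⟩
      have hmem : g X' ∈ carryValues X := ⟨X', h', rfl⟩
      rcases hC with hC | ⟨hC, -⟩
      · rw [hC] at hmem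
        rw [(ihc X' h').2 n hmem, hval]
      · simp [hC] at hmem
    by_cases hs : 0 < k ∧ m = 1 ∧ n ≠ 0
    · have hkn : prefixNat k m n = k + n := by
        unfold prefixNat
        split_ifs <;> omega
      refine Or.inl (Set.eq_singleton_iff_unique_mem.2
        ⟨hkn ▸ carry_pred hs.1 hs.2.1 hs.2.2, ?_⟩)
      rintro v ⟨L', hL', rfl⟩
      rcases (carryOption_prefix_iff hX L').1 hL' with ⟨-, rfl⟩ | ⟨X', h', rfl⟩
      · rw [ihm (by omega) n hgX, hkn, hs.2.1]
        simp [prefixValue, prefixNat]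
      · exact carry_sub _ ⟨X', h', rfl⟩
    · have carry_iff : ∀ L', CarryOption T L' →
          ∃ X', CarryOption X X' ∧ L' = bulbs k ++ sockets m ++ X' := fun L' hL' =>
        ((carryOption_prefix_iff hX L').1 hL').resolve_left fun h => hs (by simpa only [hnil] using h.1)
      rcases hC with hC | ⟨hC, hlt⟩
      · refine Or.inl (Set.eq_singleton_iff_unique_mem.2
          ⟨hval ▸ carry_coe n (by simp [hC]), ?_⟩)
        rintro v ⟨L', hL', rfl⟩
        obtain ⟨X', h', rfl⟩ := carry_iff L' hL'
        exact carry_sub _ ⟨X', h', rfl⟩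
      · refine Or.inr ⟨Set.eq_empty_iff_forall_notMem.2 ?_, fun v hv => ?_⟩
        · rintro v ⟨L', hL', rfl⟩
          obtain ⟨X', h', rfl⟩ := carry_iff L' hL'
          exact Set.eq_empty_iff_forall_notMem.1 hC _ ⟨X', h', rfl⟩
        · rcases lt_or_ge v k with hvk | hvk
          · exact ⟨bulbs v, (quietOption_prefix_iff hX _).2 (Or.inl ⟨v, hvk, rfl⟩), g_bulbs v⟩
          · rcases exists_prefixValue_eq_of_lt hs hvk hv with ⟨a, ha, hav⟩ | ⟨hm, hnv⟩
            · exact quiet_coe a v (hlt a ha) hav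
            · exact ⟨_, (quietOption_prefix_iff hX _).2
                (Or.inr (Or.inl ⟨hm, by simpa only [hnil] using hs, rfl⟩)), (ihm hm n hgX).trans hnv⟩

/-- Moonlight Theorem: If `X` is a bulb-headed component with
`g X = ∞`, then `g (bulb^k ++ socket^m ++ X) = ∞`. -/
theorem stmt8 (k m : ℕ) (X : Component) (hX : BulbHeaded X)
    (hgX : g X = (⊤ : ℕ∞)) :
    g (bulbs k ++ sockets m ++ X) = (⊤ : ℕ∞) := by
  exact (g_prefix k m X hX).1 hgX
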